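/- Let n ≥ 1, 1 ≤ k ≤ n, and let α, ᾱ ∈ ℝⁿ, Z, Z̄ ∈ ℝ^{n×k}, w, w̄ ∈ ℝ^k, γ, γ̄ ∈ ℝ satisfy J_n Z = Z, J_n Z̄ = Z̄, and rank(Z) = k. Set v = Z·w + γ·1_n and v̄ = Z̄·w̄ + γ̄·1_n. Then α·1_nᵀ + 1_n·αᵀ + Z·Zᵀ = ᾱ·1_nᵀ + 1_n·ᾱᵀ + Z̄·Z̄ᵀ and v·vᵀ = v̄·v̄ᵀ hold simultaneously if and only if there exist an orthogonal matrix O ∈ ℝ^{k×k} (OᵀO = OOᵀ = I_k) and κ ∈ {−1, 1} such that α = ᾱ, Z = Z̄·O, w = κ·Oᵀ·w̄, and γ = κ·γ̄. (Proposition 4: identifiability of the joint inner-product model.) -/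

import Mathlib

open Matrix

/-- The n×n centering matrix `J_n = I_n − (1/n) 1_n 1_nᵀ`. -/
noncomputable def centeringMatrix (n : ℕ) : Matrix (Fin n) (Fin n) ℝ :=
  1 - (n : ℝ)⁻¹ • Matrix.vecMulVec 1 1

lemma colsum_zero_aux (n k : ℕ) (hn : 1 ≤ n) (Z : Matrix (Fin n) (Fin k) ℝ)
    (hZ : centeringMatrix n * Z = Z) (j : Fin k) : ∑ i, Z i j = 0 := by
  have hn' : (n : ℝ) ≠ 0 := by positivity
  have h := congrFun (congrFun hZ ⟨0, hn⟩) j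
  rw [centeringMatrix, Matrix.sub_mul, Matrix.one_mul, Matrix.smul_mul] at h
  simp only [Matrix.sub_apply, Matrix.smul_apply, Matrix.mul_apply, Matrix.vecMulVec_apply,
    Pi.one_apply, one_mul, smul_eq_mul] at h
  have h2 : (n : ℝ)⁻¹ * ∑ i, Z i j = 0 := by linarith
  rcases mul_eq_zero.1 h2 with h3 | h3
  · exact absurd h3 (inv_ne_zero hn')
  · exact h3

lemma sum_mul_transpose_aux (n k : ℕ) (Z : Matrix (Fin n) (Fin k) ℝ)
    (h : ∀ j, ∑ i, Z i j = 0) (i : Fin n) : ∑ l, (Z * Zᵀ) i l = 0 := by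
  simp only [Matrix.mul_apply, Matrix.transpose_apply]
  rw [Finset.sum_comm]
  simp [← Finset.mul_sum, h]

lemma sum_mulVec_aux (n k : ℕ) (Z : Matrix (Fin n) (Fin k) ℝ)
    (h : ∀ j, ∑ i, Z i j = 0) (w : Fin k → ℝ) : ∑ l, (Z *ᵥ w) l = 0 := by
  simp only [Matrix.mulVec, dotProduct]
  rw [Finset.sum_comm]
  simp [← Finset.sum_mul, h]

lemma sign_aux (n : ℕ) (v v' : Fin n → ℝ) (h : vecMulVec v v = vecMulVec v' v') :
    ∃ κ : ℝ, (κ = 1 ∨ κ = -1) ∧ v = κ • v' := by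
  have hh : ∀ i j, v i * v j = v' i * v' j := fun i j => by
    simpa [vecMulVec_apply] using congrFun (congrFun h i) j
  by_cases h0 : ∀ i, v i = 0
  · refine ⟨1, Or.inl rfl, ?_⟩
    ext i
    have := hh i i
    rw [h0 i] at this
    have h1 : v' i = 0 := by simpa using this.symm
    simp [h0 i, h1]
  · push Not at h0
    obtain ⟨i, hi⟩ := h0
    rcases mul_self_eq_mul_self_iff.1 (hh i i) with h1 | h1
    · refine ⟨1, Or.inl rfl, ?_⟩
      ext j
      have h2 := hh i j
      rw [← h1] at h2
      simpa using mul_left_cancel₀ hi h2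
    · refine ⟨-1, Or.inr rfl, ?_⟩
      ext j
      have h2 := hh i j
      have h3 : v' i = - v i := by linarith
      rw [h3] at h2
      have : v j = - v' j := mul_left_cancel₀ hi (by linarith)
      simpa using this

/-- Proposition 4 (identifiability of the joint inner-product model): for centered
full-rank `Z` and `v = Z w + γ 1`, two parameter sets `(α, Z, w, γ)` and `(α', Z', w', γ')`
give the same logit matrices `Θ = α 1ᵀ + 1 αᵀ + Z Zᵀ` and `η = v vᵀ` iff they agree up to
an orthogonal transformation `O` and a sign flip `κ`: `α = α'`, `Z = Z' O`, `w = κ Oᵀ w'`,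
`γ = κ γ'`. -/
theorem joint_model_identifiability (n k : ℕ) (hn : 1 ≤ n) (hk : 1 ≤ k) (hkn : k ≤ n)
    (α α' : Fin n → ℝ) (Z Z' : Matrix (Fin n) (Fin k) ℝ) (w w' : Fin k → ℝ) (γ γ' : ℝ)
    (hZ : centeringMatrix n * Z = Z) (hZ' : centeringMatrix n * Z' = Z')
    (hrank : Z.rank = k)
    (v v' : Fin n → ℝ) (hv : v = Z.mulVec w + γ • 1) (hv' : v' = Z'.mulVec w' + γ' • 1) :
    (Matrix.vecMulVec α 1 + Matrix.vecMulVec 1 α + Z * Zᵀ =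
        Matrix.vecMulVec α' 1 + Matrix.vecMulVec 1 α' + Z' * Z'ᵀ ∧
      Matrix.vecMulVec v v = Matrix.vecMulVec v' v') ↔
    (∃ (O : Matrix (Fin k) (Fin k) ℝ) (κ : ℝ),
      Oᵀ * O = 1 ∧ O * Oᵀ = 1 ∧ (κ = 1 ∨ κ = -1) ∧
      α = α' ∧ Z = Z' * O ∧ w = κ • (Oᵀ).mulVec w' ∧ γ = κ * γ') := by
  have c := colsum_zero_aux n k hn Z hZ
  have c' := colsum_zero_aux n k hn Z' hZ'
  have hn' : (n : ℝ) ≠ 0 := by positivity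
  constructor
  · rintro ⟨h1, h2⟩
    have rs : ∀ i, n * α i + ∑ j, α j = n * α' i + ∑ j, α' j := by
      intro i
      have h3 : ∑ l, (vecMulVec α 1 + vecMulVec 1 α + Z * Zᵀ : Matrix (Fin n) (Fin n) ℝ) i l =
        ∑ l, (vecMulVec α' 1 + vecMulVec 1 α' + Z' * Z'ᵀ : Matrix (Fin n) (Fin n) ℝ) i l := by rw [h1]
      simp only [Matrix.add_apply, Finset.sum_add_distrib, sum_mul_transpose_aux n k Z c,
        sum_mul_transpose_aux n k Z' c'] at h3
      simpa [vecMulVec_apply] using h3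
    have ss : ∑ j, α j = ∑ j, α' j := by
      have h3 := Finset.sum_congr (rfl : (Finset.univ : Finset (Fin n)) = Finset.univ)
        (fun i _ => rs i)
      simp only [Finset.sum_add_distrib, ← Finset.mul_sum, Finset.sum_const, Finset.card_univ,
        Fintype.card_fin, nsmul_eq_mul] at h3
      exact mul_left_cancel₀ hn' (by linarith)
    have hα : α = α' := by
      ext i
      exact mul_left_cancel₀ hn' (by linarith [rs i])
    subst hα
    have hG : Z * Zᵀ = Z' * Z'ᵀ := add_left_cancel h1
    obtain ⟨κ, hκ, hvv⟩ := sign_aux n v v' h2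
    have hu : IsUnit (Zᵀ * Z).det := by
      rw [← Matrix.isUnit_iff_isUnit_det, ← Matrix.mulVec_surjective_iff_isUnit]
      have ht : LinearMap.range (Zᵀ * Z).mulVecLin = ⊤ := by
        apply Submodule.eq_top_of_finrank_eq
        have h5 := Matrix.rank_transpose_mul_self Z
        rw [hrank] at h5
        simpa [Matrix.rank] using h5
      exact LinearMap.range_eq_top.1 ht
    set G := Zᵀ * Z with hGd
    have hGt : Gᵀ = G := by simp [hGd]
    have hO1 : Z' * (Z'ᵀ * Z * G⁻¹) = Z := by
      rw [← Matrix.mul_assoc, ← Matrix.mul_assoc, ← hG, Matrix.mul_assoc Z, ← hGd,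
        Matrix.mul_assoc, Matrix.mul_nonsing_inv _ hu, Matrix.mul_one]
    have hO2 : (Z'ᵀ * Z * G⁻¹)ᵀ * (Z'ᵀ * Z * G⁻¹) = 1 := by
      rw [Matrix.transpose_mul, Matrix.transpose_mul, Matrix.transpose_transpose,
        Matrix.transpose_nonsing_inv, hGt, Matrix.mul_assoc, Matrix.mul_assoc, hO1, ← hGd,
        Matrix.nonsing_inv_mul _ hu]
    generalize Z'ᵀ * Z * G⁻¹ = O at hO1 hO2
    have hO3 : O * Oᵀ = 1 := mul_eq_one_comm.1 hO2
    have hZO : Z * Oᵀ = Z' := by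
      rw [← hO1, Matrix.mul_assoc, hO3, Matrix.mul_one]
    have hγ : γ = κ * γ' := by
      have h3 : ∑ i, v i = ∑ i, (κ • v') i := by rw [← hvv]
      rw [hv, hv'] at h3
      simp only [Pi.add_apply, Pi.smul_apply, smul_eq_mul, ← Finset.mul_sum,
        Finset.sum_add_distrib, sum_mulVec_aux n k Z c, sum_mulVec_aux n k Z' c', Pi.one_apply,
        Finset.sum_const, Finset.card_univ, Fintype.card_fin, nsmul_eq_mul] at h3
      exact mul_left_cancel₀ hn' (by linarith)
    refine ⟨O, κ, hO2, hO3, hκ, rfl, hO1.symm, ?_, hγ⟩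
    have h4 : Z *ᵥ w = Z *ᵥ (κ • Oᵀ *ᵥ w') := by
      rw [Matrix.mulVec_smul, Matrix.mulVec_mulVec, hZO]
      rw [hv, hv', hγ, smul_add, smul_smul] at hvv
      exact add_right_cancel hvv
    have h5 := congrArg (fun x => (G⁻¹ * Zᵀ) *ᵥ x) h4
    simp only [Matrix.mulVec_mulVec] at h5
    rw [Matrix.mul_assoc, ← hGd, Matrix.nonsing_inv_mul _ hu] at h5
    simpa using h5
  · rintro ⟨O, κ, hO2, hO3, hκ, rfl, hZO, hw, hγ⟩
    have hvv : v = κ • v' := by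
      rw [hv, hv', hγ, hw, hZO, Matrix.mulVec_smul, Matrix.mulVec_mulVec, Matrix.mul_assoc, hO3,
        Matrix.mul_one, smul_add, smul_smul]
    refine ⟨?_, ?_⟩
    · rw [hZO, Matrix.transpose_mul, Matrix.mul_assoc, ← Matrix.mul_assoc O, hO3, Matrix.one_mul]
    · rw [hvv]
      ext i j
      rcases hκ with rfl | rfl <;> simp [vecMulVec_apply]
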